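/- Let n be sufficiently large, set a_0 = (1 − 1/n)^{−2}, and let 0 < T ≤ 20 n^{−2} log n. Then there exists a lattice L ⊂ R^n with covolume Vol_n(B^n) such that a_0 |x|^2 > 1 for every 0 ≠ x ∈ L, and ∫_0^T K_t(L) dt ≤ (C/n^2) · e^{n^2 T / 8}, where C > 0 is a universal constant. -/

import Mathlib

/- STATEMENT 15 (Proposition 5.1): For n sufficiently large, a_0 = (1 − 1/n)^{−2} and
0 < T ≤ 20 n^{−2} log n, there exists a lattice L ⊂ R^n of covolume Vol_n(B^n) such that
a_0|x|² > 1 for every 0 ≠ x ∈ L and ∫_0^T K_t(L) dt ≤ (C/n²)·e^{n²T/8}, C > 0 universal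
(depending on the fixed universal constant C_0 entering the definition of D_t). -/

open MeasureTheory
noncomputable section

abbrev Euc (n : ℕ) := EuclideanSpace ℝ (Fin n)

/-- The integer lattice points `ℤ^n ⊂ ℝ^n`. -/
def intPoints (n : ℕ) : Set (Euc n) := {x | ∀ i, ∃ m : ℤ, x i = (m : ℝ)}

/-- The Gaussian tail bound function Φ(r) = min{1/2, e^{−r²/2}/(√(2π)·r)} for r > 0,
with Φ(0) = 1/2. -/
def Phi (r : ℝ) : ℝ :=
  if r = 0 then 1 / 2
  else min (1 / 2) (Real.exp (-(r ^ 2) / 2) / (Real.sqrt (2 * Real.pi) * r))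

/-- The ball `D_t = {x : (a_0 − C_0 √(tn))|x|² < 1}`. -/
def Dset {n : ℕ} (a0 C0 t : ℝ) : Set (Euc n) :=
  {x | (a0 - C0 * Real.sqrt (t * n)) * ‖x‖ ^ 2 < 1}

/-- `K_t(L) = Σ_{0 ≠ x ∈ L ∩ D_t} Φ( t^{−1/2}(a_0 − 1/|x|²) )`. -/
def Kt {n : ℕ} (C0 a0 : ℝ) (L : Set (Euc n)) (t : ℝ) : ℝ :=
  ∑' x : ↥((L ∩ Dset a0 C0 t) \ {0}),
    Phi ((a0 - 1 / ‖(x : Euc n)‖ ^ 2) / Real.sqrt t)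

/-- Each point lies in exactly `k ^ m` integer translates of the cube `[0, k)^m`. -/
theorem tsum_indicator_cube_translates (m : ℕ) (k : ℕ) (hk : 0 < k) (b : Fin m → ℝ) :
    ∑' z : Fin m → ℤ, (Set.pi Set.univ fun _ : Fin m => Set.Ico (0 : ℝ) 1).indicator
      (fun _ => (1 : ENNReal)) ((k : ℝ)⁻¹ • (b - fun i => (z i : ℝ))) = (k : ENNReal) ^ m := by
  have hk' : (0 : ℝ) < k := by exact_mod_cast hk
  set S : Finset (Fin m → ℤ) := Fintype.piFinset fun i => Finset.Ioc (⌊b i⌋ - k) ⌊b i⌋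
  have key : ∀ z : Fin m → ℤ, ((k : ℝ)⁻¹ • (b - fun i => (z i : ℝ)) ∈
      (Set.pi Set.univ fun _ : Fin m => Set.Ico (0 : ℝ) 1)) ↔ z ∈ S := by
    intro z
    simp only [Set.mem_pi, Set.mem_univ, true_implies, S, Fintype.mem_piFinset, Finset.mem_Ioc,
      Set.mem_Ico, Pi.smul_apply, Pi.sub_apply, smul_eq_mul]
    refine forall_congr' fun i => ?_
    rw [and_comm]
    refine and_congr ?_ ?_
    · rw [inv_mul_lt_iff₀ hk', mul_one, sub_lt_comm, sub_lt_iff_lt_add,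
        sub_lt_iff_lt_add (a := ⌊b i⌋), Int.floor_lt]
      push_cast
      rfl
    · rw [Int.le_floor, mul_nonneg_iff_of_pos_left (inv_pos.2 hk'), sub_nonneg]
  rw [tsum_eq_sum (s := S)]
  · rw [Finset.sum_congr rfl (g := fun _ => (1 : ENNReal))]
    · simp [S, Fintype.card_piFinset]
    · intro z hz
      exact Set.indicator_of_mem ((key z).2 hz) _
  · intro z hz
    exact Set.indicator_of_notMem (fun h => hz ((key z).1 h)) _

theorem lintegral_comp_smul_pi (m : ℕ) (g : (Fin m → ℝ) → ENNReal) (hg : Measurable g) {r : ℝ}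
    (hr : 0 < r) : ∫⁻ x, g (r • x) = ENNReal.ofReal ((r ^ m)⁻¹) * ∫⁻ x, g x := by
  have := Measure.map_addHaar_smul (volume : Measure (Fin m → ℝ)) hr.ne'
  rw [← lintegral_map hg (measurable_const_smul r), this, lintegral_smul_measure]
  simp [abs_of_pos hr]

/-- Averaging over `a` in the unit cube the sum of `g` over `ℤ^m + k • a` gives the
integral of `g`. -/
theorem lintegral_unfold_nat (m : ℕ) (g : (Fin m → ℝ) → ENNReal) (hg : Measurable g) (k : ℕ)
    (hk : 0 < k) :
    ∫⁻ a in Set.pi Set.univ fun _ : Fin m => Set.Ico (0 : ℝ) 1,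
      ∑' z : Fin m → ℤ, g ((fun i => (z i : ℝ)) + (k : ℝ) • a) = ∫⁻ y, g y := by
  have hk' : (0 : ℝ) < k := by exact_mod_cast hk
  set D : Set (Fin m → ℝ) := Set.pi Set.univ fun _ : Fin m => Set.Ico (0 : ℝ) 1
  have hD : MeasurableSet D := MeasurableSet.univ_pi fun _ => measurableSet_Ico
  have h1 : Measurable (D.indicator fun _ => (1 : ENNReal)) := measurable_const.indicator hD
  rw [lintegral_tsum (fun z => by fun_prop)]
  have h2 : ∀ z : Fin m → ℤ, ∫⁻ a in D, g ((fun i => (z i : ℝ)) + (k : ℝ) • a) =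
      ENNReal.ofReal (((k : ℝ) ^ m)⁻¹) *
        ∫⁻ b, D.indicator (fun _ => (1 : ENNReal)) ((k : ℝ)⁻¹ • (b - fun i => (z i : ℝ))) * g b := by
    intro z
    have e1 : ∫⁻ a in D, g ((fun i => (z i : ℝ)) + (k : ℝ) • a) =
        ∫⁻ a, D.indicator (fun _ => (1 : ENNReal)) ((k : ℝ)⁻¹ • ((k : ℝ) • a)) *
          g ((fun i => (z i : ℝ)) + (k : ℝ) • a) := by
      rw [← lintegral_indicator hD]
      refine lintegral_congr fun a => ?_
      rw [inv_smul_smul₀ hk'.ne']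
      by_cases ha : a ∈ D <;> simp [ha]
    rw [e1, lintegral_comp_smul_pi m (fun a => D.indicator (fun _ => (1 : ENNReal))
      ((k : ℝ)⁻¹ • a) * g ((fun i => (z i : ℝ)) + a)) (by fun_prop) hk']
    congr 1
    conv_rhs => rw [← lintegral_add_left_eq_self _ (fun i => (z i : ℝ))]
    refine lintegral_congr fun a => ?_
    rw [add_sub_cancel_left]
  simp_rw [h2]
  rw [ENNReal.tsum_mul_left, ← lintegral_tsum (fun z => by fun_prop)]
  simp_rw [ENNReal.tsum_mul_right, D, tsum_indicator_cube_translates m k hk]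
  rw [lintegral_const_mul _ hg, ← mul_assoc, ENNReal.ofReal_inv_of_pos (by positivity),
    ENNReal.ofReal_pow hk'.le, ENNReal.ofReal_natCast, ENNReal.inv_mul_cancel, one_mul]
  · positivity
  · exact ENNReal.pow_ne_top (by simp)

theorem lintegral_unfold (m : ℕ) (g : (Fin m → ℝ) → ENNReal) (hg : Measurable g)
    (heven : ∀ y, g (-y) = g y) (k : ℤ) (hk : k ≠ 0) :
    ∫⁻ a in Set.pi Set.univ fun _ : Fin m => Set.Ico (0 : ℝ) 1,
      ∑' z : Fin m → ℤ, g ((fun i => (z i : ℝ)) + (k : ℝ) • a) = ∫⁻ y, g y := by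
  obtain ⟨j, rfl | rfl⟩ := k.eq_nat_or_neg
  · simpa using lintegral_unfold_nat m g hg j (by omega)
  · rw [← lintegral_unfold_nat m g hg j (by omega)]
    refine lintegral_congr fun a => ?_
    rw [← (Equiv.neg (Fin m → ℤ)).tsum_eq]
    refine tsum_congr fun z => ?_
    rw [← heven]
    congr 1
    ext i
    simp [add_comm]

theorem tsum_le_lintegral_of_antitone (G : ℝ → ENNReal)
    (hG : ∀ s t : ℝ, |s| ≤ |t| → G t ≤ G s) :
    ∑' k : ℤ, (if k = 0 then 0 else G k) ≤ ∫⁻ s, G s := by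
  let I : ℤ → Set ℝ := fun k => if 0 < k then Set.Ioo (k - 1 : ℝ) k else Set.Ioo (k : ℝ) (k + 1)
  have hI : ∀ k : ℤ, k ≠ 0 → MeasurableSet (I k) := by
    intro k _; simp only [I]; split_ifs <;> exact measurableSet_Ioo
  have hvol : ∀ k : ℤ, volume (I k) = 1 := by
    intro k; simp only [I]; split_ifs <;> simp
  have habs : ∀ k : ℤ, k ≠ 0 → ∀ s ∈ I k, |s| ≤ |(k : ℝ)| := by
    intro k hk s hs
    simp only [I] at hs
    split_ifs at hs with h
    · have : (1 : ℝ) ≤ k := by exact_mod_cast h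
      rw [abs_of_pos (by linarith [hs.1]), abs_of_pos (by linarith)]; exact hs.2.le
    · have : (k : ℝ) ≤ -1 := by exact_mod_cast (by omega : k ≤ -1)
      rw [abs_of_neg (by linarith [hs.2]), abs_of_neg (by linarith)]; linarith [hs.1]
  calc ∑' k : ℤ, (if k = 0 then 0 else G k)
      ≤ ∑' k : ℤ, ∫⁻ s, (if k = 0 then 0 else (I k).indicator (fun _ => G k) s) := by
        refine ENNReal.tsum_le_tsum fun k => ?_
        split_ifs with h
        · simp
        · rw [lintegral_indicator (hI k h)]; simp [hvol]
    _ = ∫⁻ s, ∑' k : ℤ, (if k = 0 then 0 else (I k).indicator (fun _ => G k) s) := by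
        rw [lintegral_tsum]
        intro k
        split_ifs with h
        · fun_prop
        · exact (measurable_const.indicator (hI k h)).aemeasurable
    _ ≤ ∫⁻ s, G s := by
        refine lintegral_mono fun s => ?_
        set k₀ : ℤ := if 0 < s then ⌈s⌉ else ⌊s⌋
        have huniq : ∀ k : ℤ, k ≠ 0 → s ∈ I k → k = k₀ := by
          intro k hk hs
          simp only [I] at hs
          split_ifs at hs with h
          · have : (1 : ℝ) ≤ k := by exact_mod_cast h
            have hs0 : 0 < s := by linarith [hs.1]
            simp only [k₀, if_pos hs0]
            exact (Int.ceil_eq_iff.2 ⟨hs.1, hs.2.le⟩).symm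
          · have : (k : ℝ) ≤ -1 := by exact_mod_cast (by omega : k ≤ -1)
            have hs0 : ¬ 0 < s := by linarith [hs.2]
            simp only [k₀, if_neg hs0]
            exact (Int.floor_eq_iff.2 ⟨hs.1.le, hs.2⟩).symm
        dsimp only
        rw [tsum_eq_single k₀]
        · split_ifs with h
          · exact zero_le
          · by_cases hs : s ∈ I k₀
            · rw [Set.indicator_of_mem hs]; exact hG _ _ (habs _ h s hs)
            · rw [Set.indicator_of_notMem hs]; exact zero_le
        · intro k hk
          split_ifs with h
          · rfl
          · exact Set.indicator_of_notMem (fun hs => hk (huniq k h hs)) _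

/-- The matrix of `(s, y) ↦ (β * s, α * (y + s * a))` on `ℝ × ℝ^m`. -/
def shearMatrix {m : ℕ} (α β : ℝ) (a : Fin m → ℝ) : Matrix (Fin (m + 1)) (Fin (m + 1)) ℝ :=
  Matrix.of (Fin.cons (Fin.cons β 0) fun i => Fin.cons (α * a i) (Pi.single i α))

theorem det_shearMatrix {m : ℕ} (α β : ℝ) (a : Fin m → ℝ) :
    (shearMatrix α β a).det = α ^ m * β := by
  rw [Matrix.det_of_isLowerTriangular, Fin.prod_univ_succ]
  · simp [shearMatrix, mul_comm]
  · intro i j hij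
    replace hij : i < j := hij
    induction i using Fin.cases with
    | zero =>
      induction j using Fin.cases with
      | zero => simp at hij
      | succ j => simp [shearMatrix]
    | succ i =>
      induction j using Fin.cases with
      | zero => simp at hij
      | succ j =>
        have : i ≠ j := by rintro rfl; simp at hij
        simp [shearMatrix, this.symm]

/-- The linear map `(s, y) ↦ (β * s, α * (y + s * a))` on `ℝ^(m+1)`. -/
def shearMap {m : ℕ} (α β : ℝ) (a : Fin m → ℝ) : Euc (m + 1) →ₗ[ℝ] Euc (m + 1) :=
  Matrix.toEuclideanLin (shearMatrix α β a)

theorem det_shearMap {m : ℕ} (α β : ℝ) (a : Fin m → ℝ) :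
    LinearMap.det (shearMap α β a) = α ^ m * β := by
  rw [shearMap, Matrix.toEuclideanLin_eq_toLin_orthonormal, LinearMap.det_toLin, det_shearMatrix]

/-- The Euclidean norm of `(β * s, α * y)`. -/
def shearNorm {m : ℕ} (α β s : ℝ) (y : Fin m → ℝ) : ℝ :=
  √((β * s) ^ 2 + ∑ i, (α * y i) ^ 2)

theorem norm_shearMap {m : ℕ} (α β : ℝ) (a : Fin m → ℝ) (x : Euc (m + 1)) :
    ‖shearMap α β a x‖ = shearNorm α β (x 0) ((fun i => x i.succ) + x 0 • a) := by
  rw [EuclideanSpace.norm_eq, shearNorm, Fin.sum_univ_succ]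
  have h0 : shearMap α β a x 0 = β * x 0 := by
    simp [shearMap, shearMatrix, Matrix.mulVec, dotProduct, Fin.sum_univ_succ]
  have h1 : ∀ i : Fin m, shearMap α β a x i.succ = α * (x i.succ + x 0 * a i) := by
    intro i
    simp [shearMap, shearMatrix, Matrix.mulVec, dotProduct, Fin.sum_univ_succ, Pi.single_apply]
    ring
  simp_rw [h0, h1, Real.norm_eq_abs, sq_abs]
  simp

theorem lintegral_shearNorm {m : ℕ} {α β : ℝ} (hα : 0 < α) (hβ : 0 < β) (f : ℝ → ENNReal)
    (hf : Measurable f) :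
    ∫⁻ s, ∫⁻ y : Fin m → ℝ, f (shearNorm α β s y) =
      (∫⁻ x : Euc (m + 1), f ‖x‖) / ENNReal.ofReal (α ^ m * β) := by
  have hd : LinearMap.det (shearMap α β (0 : Fin m → ℝ)) = α ^ m * β := det_shearMap ..
  have hV : 0 < α ^ m * β := by positivity
  have hmeas : Measurable fun p : ℝ × (Fin m → ℝ) => f (shearNorm α β p.1 p.2) := by
    unfold shearNorm; fun_prop
  rw [← lintegral_prod _ hmeas.aemeasurable, ← Measure.volume_eq_prod]
  have e1 := (volume_preserving_piFinSuccAbove (fun _ : Fin (m + 1) => ℝ) 0).lintegral_comp hmeas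
  have e2 := (PiLp.volume_preserving_ofLp (Fin (m + 1))).lintegral_comp
    (hmeas.comp (MeasurableEquiv.piFinSuccAbove (fun _ : Fin (m + 1) => ℝ) 0).measurable)
  rw [← e1]
  simp only [Function.comp_def] at e2
  rw [← e2]
  have hcont : Measurable (shearMap α β (0 : Fin m → ℝ)) :=
    (LinearMap.continuous_of_finiteDimensional _).measurable
  have e3 := lintegral_map (μ := (volume : Measure (Euc (m + 1))))
    (f := fun x => f ‖x‖) (by fun_prop) hcont
  rw [Measure.map_linearMap_addHaar_eq_smul_addHaar _ (by rw [hd]; exact hV.ne'), hd,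
    lintegral_smul_measure, abs_of_pos (inv_pos.2 hV), ENNReal.ofReal_inv_of_pos hV] at e3
  rw [ENNReal.div_eq_inv_mul]
  rw [smul_eq_mul] at e3
  rw [e3]
  refine lintegral_congr fun x => ?_
  rw [norm_shearMap]
  simp [MeasurableEquiv.piFinSuccAbove, Fin.tail_def]

theorem shearNorm_mono {m : ℕ} {α β : ℝ} {s t : ℝ} (h : |s| ≤ |t|) (y : Fin m → ℝ) :
    shearNorm α β s y ≤ shearNorm α β t y := by
  refine Real.sqrt_le_sqrt ?_
  rw [mul_pow, mul_pow]
  have := sq_le_sq.2 h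
  gcongr

/-- Siegel's mean value bound: some lattice of covolume `V` has its sum of a compactly supported
radially decreasing function over nonzero points at most the integral divided by `V`. -/
theorem exists_lattice_tsum_le (m : ℕ) {V : ℝ} (hV : 0 < V) (f : ℝ → ENNReal) (hf : Antitone f)
    {R : ℝ} (hR : ∀ r, R < r → f r = 0) :
    ∃ T : Euc (m + 1) ≃ₗ[ℝ] Euc (m + 1),
      |LinearMap.det (T : Euc (m + 1) →ₗ[ℝ] Euc (m + 1))| = V ∧
      ∑' z : Fin (m + 1) → ℤ, (if z = 0 then 0 else f ‖T (WithLp.toLp 2 fun i => (z i : ℝ))‖) ≤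
        (∫⁻ x : Euc (m + 1), f ‖x‖) / ENNReal.ofReal V := by
  have hfm : Measurable f := hf.measurable
  set α : ℝ := max 1 (R + 1)
  have hα : 0 < α := lt_of_lt_of_le one_pos (le_max_left _ _)
  set β : ℝ := V / α ^ m
  have hβ : 0 < β := by positivity
  have hdet : α ^ m * β = V := by simp only [β]; field_simp
  have hN : Measurable fun p : ℝ × (Fin m → ℝ) => shearNorm α β p.1 p.2 := by
    unfold shearNorm; fun_prop
  have hNm : ∀ s, Measurable fun y : Fin m → ℝ => f (shearNorm α β s y) := fun s =>
    hfm.comp (hN.comp measurable_prodMk_left)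
  set D : Set (Fin m → ℝ) := Set.pi Set.univ fun _ : Fin m => Set.Ico (0 : ℝ) 1
  have hprob : IsProbabilityMeasure (volume.restrict D) :=
    ⟨by simp [D, volume_pi_pi]⟩
  set F : (Fin m → ℝ) → ENNReal := fun a => ∑' k : ℤ, (if k = 0 then 0 else
    ∑' z : Fin m → ℤ, f (shearNorm α β k ((fun i => (z i : ℝ)) + (k : ℝ) • a)))
  have hFm : ∀ k : ℤ, Measurable fun a : Fin m → ℝ =>
      (if k = 0 then (0 : ENNReal) else
        ∑' z : Fin m → ℤ, f (shearNorm α β k ((fun i => (z i : ℝ)) + (k : ℝ) • a))) := by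
    intro k
    split_ifs
    · fun_prop
    · exact Measurable.tsum fun z => (hNm k).comp (by fun_prop)
  obtain ⟨a, ha⟩ := exists_le_lintegral (μ := volume.restrict D) (f := F)
    (Measurable.tsum hFm).aemeasurable
  have hFint : ∫⁻ a in D, F a ≤ (∫⁻ x : Euc (m + 1), f ‖x‖) / ENNReal.ofReal V := by
    rw [← hdet, ← lintegral_shearNorm hα hβ f hfm]
    simp only [F]
    rw [lintegral_tsum fun k => (hFm k).aemeasurable]
    refine le_trans (le_of_eq ?_) (tsum_le_lintegral_of_antitone
      (fun s => ∫⁻ y : Fin m → ℝ, f (shearNorm α β s y))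
      fun s t h => lintegral_mono fun y => hf (shearNorm_mono h y))
    refine tsum_congr fun k => ?_
    split_ifs with hk
    · simp
    · exact lintegral_unfold m (fun y => f (shearNorm α β k y)) (hNm k)
        (fun y => by simp [shearNorm]) k hk
  refine ⟨(shearMap α β a).equivOfDetNeZero (by rw [det_shearMap, hdet]; exact hV.ne'), ?_, ?_⟩
  · change |LinearMap.det (shearMap α β a)| = V
    rw [det_shearMap, hdet, abs_of_pos hV]
  · refine le_trans (le_of_eq ?_) (ha.trans hFint)
    simp only [F]
    rw [← (Fin.consEquiv fun _ => ℤ).tsum_eq, ENNReal.tsum_prod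
      (f := fun k z => if (Fin.consEquiv fun _ => ℤ) (k, z) = 0 then 0 else
        f ‖((shearMap α β a).equivOfDetNeZero _) (WithLp.toLp 2 fun i =>
          (((Fin.consEquiv fun _ => ℤ) (k, z) : Fin (m + 1) → ℤ) i : ℝ))‖)]
    refine tsum_congr fun k => ?_
    have hk : ∀ z : Fin m → ℤ, ‖shearMap α β a (WithLp.toLp 2 fun i =>
          (((Fin.consEquiv fun _ => ℤ) (k, z) : Fin (m + 1) → ℤ) i : ℝ))‖ =
        shearNorm α β k ((fun i => (z i : ℝ)) + (k : ℝ) • a) := by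
      intro z
      rw [norm_shearMap]
      simp [Fin.consEquiv]
    change ∑' z : Fin m → ℤ, (if (Fin.consEquiv fun _ => ℤ) (k, z) = 0 then 0 else
      f ‖shearMap α β a (WithLp.toLp 2 fun i =>
        (((Fin.consEquiv fun _ => ℤ) (k, z) : Fin (m + 1) → ℤ) i : ℝ))‖) = _
    simp only [hk]
    split_ifs with h
    · subst h
      rw [ENNReal.tsum_eq_zero]
      intro z
      split_ifs with hz
      · rfl
      · have hz0 : z ≠ 0 := by
          rintro rfl
          apply hz
          ext i
          refine Fin.cases ?_ (fun i => ?_) i <;> simp [Fin.consEquiv]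
        obtain ⟨i, hi⟩ := Function.ne_iff.1 hz0
        apply hR
        have h1 : (1 : ℝ) ≤ |(z i : ℝ)| := by exact_mod_cast Int.one_le_abs hi
        refine lt_of_lt_of_le (lt_of_lt_of_le (lt_add_one R) (le_max_right 1 _)) ?_
        refine Real.le_sqrt_of_sq_le ?_
        have h2 : (α * (((fun i => (z i : ℝ)) + ((0 : ℤ) : ℝ) • a) i)) ^ 2 ≤
            ∑ i, (α * (((fun i => (z i : ℝ)) + ((0 : ℤ) : ℝ) • a) i)) ^ 2 :=
          Finset.single_le_sum
            (f := fun i => (α * (((fun i => (z i : ℝ)) + ((0 : ℤ) : ℝ) • a) i)) ^ 2)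
            (fun _ _ => sq_nonneg _) (Finset.mem_univ i)
        have h3 : (1 : ℝ) ≤ (z i : ℝ) ^ 2 := by rw [← sq_abs]; nlinarith
        have h4 : α ^ 2 ≤ (α * (z i : ℝ)) ^ 2 := by
          rw [mul_pow]; nlinarith [sq_nonneg α]
        simp only [Pi.add_apply, Int.cast_zero, zero_smul, Pi.zero_apply, add_zero] at h2 ⊢
        exact h4.trans (h2.trans (le_add_of_nonneg_left (sq_nonneg _)))
    · refine tsum_congr fun z => ?_
      rw [if_neg]
      intro hz
      exact h (by simpa [Fin.consEquiv] using congrFun hz 0)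

/-- Integration of a radial function in polar coordinates. -/
theorem lintegral_fun_norm (m : ℕ) (f : ℝ → ENNReal) (hf : Measurable f) :
    ∫⁻ x : Euc (m + 1), f ‖x‖ = ((m + 1 : ℕ) : ENNReal) * volume (Metric.ball (0 : Euc (m + 1)) 1) *
      ∫⁻ r in Set.Ioi (0 : ℝ), ENNReal.ofReal (r ^ m) * f r := by
  have hd : Module.finrank ℝ (Euc (m + 1)) = m + 1 := by simp
  have e0 : ∫⁻ x : Euc (m + 1), f ‖x‖ =
      ∫⁻ x : ({0}ᶜ : Set (Euc (m + 1))), f ‖(x : Euc (m + 1))‖ ∂(volume.comap Subtype.val) := by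
    rw [lintegral_subtype_comap (measurableSet_singleton _).compl fun x : Euc (m + 1) => f ‖x‖,
      restrict_compl_singleton]
  have e1 := ((volume : Measure (Euc (m + 1))).measurePreserving_homeomorphUnitSphereProd
    ).lintegral_comp (f := fun p => f p.2) (by fun_prop)
  rw [lintegral_prod _ (by fun_prop)] at e1
  simp only [lintegral_const, Measure.toSphere_apply_univ, hd, Nat.add_sub_cancel,
    homeomorphUnitSphereProd_apply_snd_coe] at e1
  rw [e0, e1, mul_comm, Measure.volumeIoiPow,
    lintegral_withDensity_eq_lintegral_mul _ (by fun_prop) (by fun_prop)]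
  congr 1
  exact lintegral_subtype_comap measurableSet_Ioi fun r : ℝ => ENNReal.ofReal (r ^ m) * f r

theorem Phi_le_half (q : ℝ) : Phi q ≤ 1 / 2 := by
  unfold Phi; split_ifs
  · exact le_rfl
  · exact min_le_left _ _

theorem Phi_nonneg {q : ℝ} (hq : 0 ≤ q) : 0 ≤ Phi q := by
  unfold Phi; split_ifs
  · norm_num
  · positivity

theorem Phi_antitoneOn : AntitoneOn Phi (Set.Ici 0) := by
  intro p hp q hq hpq
  rw [Set.mem_Ici] at hp hq
  rcases hp.eq_or_lt with rfl | hp0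
  · simpa [Phi] using Phi_le_half q
  · have hq0 : 0 < q := hp0.trans_le hpq
    rw [Phi, Phi, if_neg hp0.ne', if_neg hq0.ne']
    gcongr

theorem measurable_Phi : Measurable Phi := by
  unfold Phi
  exact Measurable.ite (measurableSet_singleton 0) measurable_const (by fun_prop)

theorem mul_exp_mul_Phi_le {q s : ℝ} (hq : 0 < q) (hs : 0 ≤ s) :
    s * (Real.exp (s * q) * Phi q) ≤
      2 * Real.exp (s ^ 2 / 2) * Real.exp (-(q - s) ^ 2 / 4) := by
  have habs : 1 + |s - q| ≤ 2 * Real.exp ((q - s) ^ 2 / 4) := by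
    have h1 := Real.add_one_le_exp ((q - s) ^ 2 / 4)
    have h2 : |s - q| ^ 2 = (q - s) ^ 2 := by rw [sq_abs]; ring
    nlinarith [sq_nonneg (|s - q| - 2)]
  have hPhi : s * Phi q ≤ (1 + |s - q|) * Real.exp (-(q ^ 2) / 2) := by
    rcases le_total q 1 with h1 | h1
    · have he : 1 / 2 ≤ Real.exp (-(q ^ 2) / 2) := by
        have := Real.add_one_le_exp (-(q ^ 2) / 2)
        nlinarith
      have hs' : s ≤ 1 + |s - q| := by linarith [le_abs_self (s - q)]
      exact mul_le_mul hs' ((Phi_le_half q).trans he) (Phi_nonneg hq.le) (by positivity)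
    · have hP : Phi q ≤ Real.exp (-(q ^ 2) / 2) / q := by
        rw [Phi, if_neg hq.ne']
        refine (min_le_right _ _).trans ?_
        refine div_le_div_of_nonneg_left (Real.exp_pos _).le hq ?_
        refine le_mul_of_one_le_left hq.le (Real.one_le_sqrt.2 ?_)
        linarith [Real.pi_gt_three]
      have hs' : s / q ≤ 1 + |s - q| := by
        rw [div_le_iff₀ hq]
        nlinarith [le_abs_self (s - q), abs_nonneg (s - q)]
      calc s * Phi q ≤ s * (Real.exp (-(q ^ 2) / 2) / q) := by gcongr
        _ = s / q * Real.exp (-(q ^ 2) / 2) := by ring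
        _ ≤ _ := by gcongr
  calc s * (Real.exp (s * q) * Phi q) = Real.exp (s * q) * (s * Phi q) := by ring
    _ ≤ Real.exp (s * q) * ((2 * Real.exp ((q - s) ^ 2 / 4)) * Real.exp (-(q ^ 2) / 2)) := by
        refine mul_le_mul_of_nonneg_left (hPhi.trans ?_) (Real.exp_pos _).le
        exact mul_le_mul_of_nonneg_right habs (Real.exp_pos _).le
    _ = 2 * (Real.exp (s * q) * Real.exp ((q - s) ^ 2 / 4) * Real.exp (-(q ^ 2) / 2)) := by ring
    _ = 2 * (Real.exp (s ^ 2 / 2) * Real.exp (-(q - s) ^ 2 / 4)) := by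
        simp only [← Real.exp_add]; congr 2; ring
    _ = _ := by ring

theorem lintegral_exp_neg_sq_affine {p c : ℝ} (hp : 0 < p) :
    ∫⁻ x : ℝ, ENNReal.ofReal (Real.exp (-(p * x - c) ^ 2 / 4)) =
      ENNReal.ofReal (√(4 * Real.pi) / p) := by
  have h1 : ∀ x : ℝ, -(p * x - c) ^ 2 / 4 = -(p ^ 2 / 4) * (x - c / p) ^ 2 := by
    intro x; field_simp
  simp_rw [h1]
  rw [lintegral_sub_right_eq_self (fun x => ENNReal.ofReal (Real.exp (-(p ^ 2 / 4) * x ^ 2))),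
    ← ofReal_integral_eq_lintegral_ofReal (integrable_exp_neg_mul_sq (by positivity))
      (Filter.Eventually.of_forall fun x => (Real.exp_pos _).le), integral_gaussian]
  congr 1
  rw [show Real.pi / (p ^ 2 / 4) = 4 * Real.pi / p ^ 2 by field_simp, Real.sqrt_div' _ (sq_nonneg p),
    Real.sqrt_sq hp.le]

/-- The radial profile `Φ(t^{-1/2}(ρ^{-2} - r^{-2}))`, continued by `1/2` to `r ≤ ρ`. -/
def profile (ρ t r : ℝ) : ℝ :=
  if r ≤ ρ then 1 / 2 else Phi (((ρ ^ 2)⁻¹ - 1 / r ^ 2) / √t)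

theorem profile_arg_nonneg {ρ : ℝ} (hρ : 0 < ρ) (t : ℝ) {r : ℝ} (hr : ρ < r) :
    0 ≤ ((ρ ^ 2)⁻¹ - 1 / r ^ 2) / √t := by
  refine div_nonneg (sub_nonneg.2 ?_) (Real.sqrt_nonneg _)
  rw [one_div]
  gcongr

theorem profile_nonneg {ρ : ℝ} (hρ : 0 < ρ) (t r : ℝ) : 0 ≤ profile ρ t r := by
  unfold profile; split_ifs with h
  · norm_num
  · exact Phi_nonneg (profile_arg_nonneg hρ t (not_le.1 h))

theorem profile_le_half (ρ t r : ℝ) : profile ρ t r ≤ 1 / 2 := by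
  unfold profile; split_ifs
  · exact le_rfl
  · exact Phi_le_half _

theorem profile_antitone {ρ : ℝ} (hρ : 0 < ρ) (t : ℝ) : Antitone (profile ρ t) := by
  intro a b hab
  by_cases ha : a ≤ ρ
  · rw [profile.eq_def ρ t a, if_pos ha]; exact profile_le_half _ _ _
  · have ha' := not_le.1 ha
    have hb : ρ < b := ha'.trans_le hab
    have ha0 : 0 < a := hρ.trans ha'
    rw [profile, profile, if_neg ha, if_neg hb.not_ge]
    refine Phi_antitoneOn (profile_arg_nonneg hρ t ha') (profile_arg_nonneg hρ t hb) ?_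
    gcongr

theorem measurable_profile (ρ : ℝ) : Measurable fun p : ℝ × ℝ => profile ρ p.1 p.2 := by
  unfold profile
  refine Measurable.ite (measurableSet_le measurable_snd measurable_const) measurable_const ?_
  exact measurable_Phi.comp (by fun_prop)

theorem two_mul_le_profile_arg {ρ W r : ℝ} (hρ : 0 < ρ) (hρ1 : ρ ≤ 1) (hr : ρ < r)
    (hrW : r ≤ ρ * (1 + W)) :
    2 * (1 - 3 * W / 2) * (r / ρ - 1) ≤ (ρ ^ 2)⁻¹ - 1 / r ^ 2 := by
  set w := r / ρ - 1 with hw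
  have hrw : r = ρ * (1 + w) := by rw [hw]; field_simp; ring
  have hw0 : 0 < w := by rw [hw, sub_pos, one_lt_div hρ]; exact hr
  have hwW : w ≤ W := by
    rw [hrw] at hrW
    linarith [le_of_mul_le_mul_left hrW hρ]
  have h1 : 2 * (1 - 3 * W / 2) * w ≤ 1 - 1 / (1 + w) ^ 2 := by
    have h2 : 2 * (1 - 3 * W / 2) * w ≤ (2 - 3 * w) * w := by nlinarith
    refine h2.trans ?_
    rw [le_sub_iff_add_le, ← le_sub_iff_add_le', div_le_iff₀ (by positivity)]
    nlinarith [pow_pos hw0 2, pow_pos hw0 3, pow_pos hw0 4]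
  refine h1.trans ?_
  have h3 : (ρ ^ 2)⁻¹ - 1 / r ^ 2 = (ρ ^ 2)⁻¹ * (1 - 1 / (1 + w) ^ 2) := by
    rw [hrw]; field_simp
  rw [h3]
  refine le_mul_of_one_le_left ?_ ((one_le_inv₀ (by positivity)).2 (by nlinarith))
  rw [sub_nonneg, div_le_one (by positivity)]
  nlinarith

theorem pow_mul_profile_le (m : ℕ) {ρ W t r : ℝ} (hρ : 0 < ρ) (hρ1 : ρ ≤ 1) (hW : W ≤ 1 / 10)
    (ht : 0 < t) (hr : ρ < r) (hrW : r ≤ ρ * (1 + W)) :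
    (m + 1) * (r ^ m * profile ρ t r) ≤
      2 * (2 * (1 - 3 * W / 2) / √t) *
        Real.exp (((m + 1) / (2 * (1 - 3 * W / 2) / √t)) ^ 2 / 2) *
        Real.exp (-((2 * (1 - 3 * W / 2) / √t) / ρ * r - ((2 * (1 - 3 * W / 2) / √t) +
          (m + 1) / (2 * (1 - 3 * W / 2) / √t))) ^ 2 / 4) := by
  have hst : 0 < √t := Real.sqrt_pos.2 ht
  set l : ℝ := 2 * (1 - 3 * W / 2) / √t with hl
  have hl0 : 0 < l := div_pos (by linarith) hst
  set w := r / ρ - 1 with hw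
  have hrw : r = ρ * (1 + w) := by rw [hw]; field_simp; ring
  have hw0 : 0 < w := by rw [hw, sub_pos, one_lt_div hρ]; exact hr
  set s : ℝ := (m + 1) / l with hs
  have hs0 : 0 ≤ s := by positivity
  have harg : l * w ≤ ((ρ ^ 2)⁻¹ - 1 / r ^ 2) / √t := by
    rw [hl, div_mul_eq_mul_div]
    gcongr
    exact two_mul_le_profile_arg hρ hρ1 hr hrW
  have hprof : profile ρ t r ≤ Phi (l * w) := by
    rw [profile, if_neg hr.not_ge]
    exact Phi_antitoneOn (Set.mem_Ici.2 (by positivity)) (profile_arg_nonneg hρ t hr) harg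
  have hrm : r ^ m ≤ Real.exp (s * (l * w)) := by
    have h1 : r ≤ Real.exp w := by
      have := Real.add_one_le_exp w
      nlinarith
    calc r ^ m ≤ Real.exp w ^ m := by gcongr; exact (hρ.trans hr).le
      _ = Real.exp (m * w) := by rw [← Real.exp_nat_mul]
      _ ≤ _ := by
        rw [Real.exp_le_exp, hs]
        have : (m + 1) / l * (l * w) = (m + 1) * w := by field_simp
        rw [this]; nlinarith
  have hmain := mul_exp_mul_Phi_le (mul_pos hl0 hw0) hs0
  have hm : ((m : ℝ) + 1) = l * s := by rw [hs]; field_simp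
  calc ((m : ℝ) + 1) * (r ^ m * profile ρ t r)
      ≤ (m + 1) * (Real.exp (s * (l * w)) * Phi (l * w)) := by
        gcongr
        exact profile_nonneg hρ t r
    _ = l * (s * (Real.exp (s * (l * w)) * Phi (l * w))) := by rw [hm]; ring
    _ ≤ l * (2 * Real.exp (s ^ 2 / 2) * Real.exp (-(l * w - s) ^ 2 / 4)) := by gcongr
    _ = _ := by
        have : l * w - s = l / ρ * r - (l + s) := by rw [hw]; ring
        rw [this]; ring

theorem lintegral_profile_le (m : ℕ) {ρ W t : ℝ} (hρ : 0 < ρ) (hρ1 : ρ ≤ 1) (hW0 : 0 ≤ W)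
    (hW : W ≤ 1 / 10) (ht : 0 < t) (htW : (m + 1) ^ 2 * t / 8 * (6 * W) ≤ 1) :
    ∫⁻ x : Euc (m + 1), ENNReal.ofReal (if ‖x‖ ≤ ρ * (1 + W) then profile ρ t ‖x‖ else 0) ≤
      volume (Metric.ball (0 : Euc (m + 1)) 1) *
        ENNReal.ofReal (30 * Real.exp ((m + 1) ^ 2 * t / 8)) := by
  have hst : 0 < √t := Real.sqrt_pos.2 ht
  set l : ℝ := 2 * (1 - 3 * W / 2) / √t with hl
  have hl0 : 0 < l := div_pos (by linarith) hst
  set s : ℝ := (m + 1) / l with hs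
  set E : ℝ := Real.exp ((m + 1) ^ 2 * t / 8) with hE
  have hE1 : 1 ≤ E := Real.one_le_exp (by positivity)
  have hsE : Real.exp (s ^ 2 / 2) ≤ 2.7182818286 * E := by
    have h1 : s ^ 2 / 2 ≤ 1 + (m + 1) ^ 2 * t / 8 := by
      have h2 : s ^ 2 / 2 = (m + 1) ^ 2 * t / 8 * (1 / (1 - 3 * W / 2) ^ 2) := by
        rw [hs, hl, div_div_eq_mul_div, div_pow, mul_pow, mul_pow, Real.sq_sqrt ht.le]
        have : 1 - 3 * W / 2 ≠ 0 := by linarith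
        field_simp
        ring
      have h3 : 1 / (1 - 3 * W / 2) ^ 2 ≤ 1 + 6 * W := by
        rw [div_le_iff₀ (by nlinarith)]
        nlinarith [mul_nonneg hW0 hW0, mul_nonneg hW0 (mul_nonneg hW0 hW0)]
      rw [h2]
      calc _ ≤ (m + 1) ^ 2 * t / 8 * (1 + 6 * W) := by gcongr
        _ ≤ _ := by linarith
    calc Real.exp (s ^ 2 / 2) ≤ Real.exp (1 + (m + 1) ^ 2 * t / 8) := Real.exp_le_exp.2 h1
      _ = Real.exp 1 * E := by rw [Real.exp_add]
      _ ≤ _ := by gcongr; exact Real.exp_one_lt_d9.le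
  have hpi : √(4 * Real.pi) ≤ 4 := by
    rw [Real.sqrt_le_left (by norm_num)]; linarith [Real.pi_lt_four]
  have hmp : ∀ t : ℝ, Measurable (profile ρ t) := fun t => (profile_antitone hρ t).measurable
  set h : ℝ → ℝ := fun r => if ρ < r ∧ r ≤ ρ * (1 + W) then profile ρ t r else 0
  have hh : Measurable h := Measurable.ite
    ((measurableSet_Ioc : MeasurableSet (Set.Ioc ρ (ρ * (1 + W))))) (hmp t) measurable_const
  have hsplit : ∀ x : Euc (m + 1),
      ENNReal.ofReal (if ‖x‖ ≤ ρ * (1 + W) then profile ρ t ‖x‖ else 0) ≤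
        (Metric.closedBall (0 : Euc (m + 1)) 1).indicator (fun _ => ENNReal.ofReal (1 / 2)) x +
          ENNReal.ofReal (h ‖x‖) := by
    intro x
    by_cases hx : ‖x‖ ≤ ρ
    · rw [Set.indicator_of_mem (by simpa using hx.trans hρ1)]
      refine le_add_right (ENNReal.ofReal_le_ofReal ?_)
      split_ifs
      · exact profile_le_half _ _ _
      · norm_num
    · refine le_add_left (le_of_eq ?_)
      simp [h, not_le.1 hx]
  have hradial : ∫⁻ x : Euc (m + 1), ENNReal.ofReal (h ‖x‖) ≤
      volume (Metric.ball (0 : Euc (m + 1)) 1) * ENNReal.ofReal (29 * E) := by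
    rw [lintegral_fun_norm m (fun r => ENNReal.ofReal (h r)) (by fun_prop), mul_comm (_ : ENNReal)
      (volume _), mul_assoc]
    gcongr
    rw [← lintegral_const_mul _ (by fun_prop)]
    calc ∫⁻ r in Set.Ioi (0 : ℝ), ((m + 1 : ℕ) : ENNReal) *
          (ENNReal.ofReal (r ^ m) * ENNReal.ofReal (h r))
        ≤ ∫⁻ r in Set.Ioi (0 : ℝ), ENNReal.ofReal (2 * l * Real.exp (s ^ 2 / 2)) *
            ENNReal.ofReal (Real.exp (-(l / ρ * r - (l + s)) ^ 2 / 4)) := by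
          refine setLIntegral_mono (by fun_prop) fun r hr => ?_
          have hr0 : 0 < r := hr
          rw [← ENNReal.ofReal_natCast, ← ENNReal.ofReal_mul (by positivity),
            ← ENNReal.ofReal_mul (by positivity), ← ENNReal.ofReal_mul (by positivity)]
          refine ENNReal.ofReal_le_ofReal ?_
          simp only [h]
          split_ifs with hc
          · push_cast
            exact pow_mul_profile_le m hρ hρ1 hW ht hc.1 hc.2
          · rw [mul_zero, mul_zero]; positivity
      _ ≤ ∫⁻ r, ENNReal.ofReal (2 * l * Real.exp (s ^ 2 / 2)) *
            ENNReal.ofReal (Real.exp (-(l / ρ * r - (l + s)) ^ 2 / 4)) :=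
          setLIntegral_le_lintegral _ _
      _ = ENNReal.ofReal (2 * l * Real.exp (s ^ 2 / 2) * (√(4 * Real.pi) / (l / ρ))) := by
          rw [lintegral_const_mul _ (by fun_prop), lintegral_exp_neg_sq_affine (by positivity),
            ← ENNReal.ofReal_mul (by positivity)]
      _ ≤ _ := by
          refine ENNReal.ofReal_le_ofReal ?_
          have : 2 * l * Real.exp (s ^ 2 / 2) * (√(4 * Real.pi) / (l / ρ)) =
              2 * Real.exp (s ^ 2 / 2) * √(4 * Real.pi) * ρ := by field_simp
          rw [this]
          calc 2 * Real.exp (s ^ 2 / 2) * √(4 * Real.pi) * ρ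
              ≤ 2 * (2.7182818286 * E) * 4 * 1 := by gcongr
            _ ≤ 29 * E := by linarith
  calc _ ≤ ∫⁻ x : Euc (m + 1),
        ((Metric.closedBall (0 : Euc (m + 1)) 1).indicator (fun _ => ENNReal.ofReal (1 / 2)) x +
          ENNReal.ofReal (h ‖x‖)) := lintegral_mono hsplit
    _ = volume (Metric.ball (0 : Euc (m + 1)) 1) * ENNReal.ofReal (1 / 2) +
          ∫⁻ x : Euc (m + 1), ENNReal.ofReal (h ‖x‖) := by
        rw [lintegral_add_right _ (by fun_prop), lintegral_indicator measurableSet_closedBall,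
          setLIntegral_const, Measure.addHaar_closedBall_eq_addHaar_ball, mul_comm]
    _ ≤ volume (Metric.ball (0 : Euc (m + 1)) 1) * ENNReal.ofReal (1 / 2) +
          volume (Metric.ball (0 : Euc (m + 1)) 1) * ENNReal.ofReal (29 * E) := by gcongr
    _ = volume (Metric.ball (0 : Euc (m + 1)) 1) * ENNReal.ofReal (1 / 2 + 29 * E) := by
        rw [← mul_add, ENNReal.ofReal_add (by norm_num) (by positivity)]
    _ ≤ _ := by gcongr; linarith

theorem setLIntegral_exp_mul_le {c T : ℝ} (hc : 0 < c) (hT : 0 ≤ T) :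
    ∫⁻ t in Set.Ioc 0 T, ENNReal.ofReal (Real.exp (c * t)) ≤
      ENNReal.ofReal (Real.exp (c * T) / c) := by
  have hi : IntervalIntegrable (fun t => Real.exp (c * t)) volume 0 T :=
    Continuous.intervalIntegrable (by fun_prop) _ _
  rw [← ofReal_integral_eq_lintegral_ofReal
    ((intervalIntegrable_iff_integrableOn_Ioc_of_le hT).1 hi)
    (Filter.Eventually.of_forall fun t => (Real.exp_pos _).le),
    ← intervalIntegral.integral_of_le hT,
    intervalIntegral.integral_comp_mul_left (fun t => Real.exp t) hc.ne', integral_exp]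
  refine ENNReal.ofReal_le_ofReal ?_
  rw [smul_eq_mul, inv_mul_eq_div]
  gcongr
  linarith [Real.exp_pos (c * 0)]

/-- The total weight over `0 < t ≤ T` of the radial profile at `r`, cut off at
`r = ρ * (1 + W)`. -/
def profileWeight (ρ W T r : ℝ) : ENNReal :=
  ∫⁻ t in Set.Ioc 0 T, ENNReal.ofReal (if r ≤ ρ * (1 + W) then profile ρ t r else 0)

theorem profileWeight_antitone {ρ : ℝ} (hρ : 0 < ρ) (W T : ℝ) :
    Antitone (profileWeight ρ W T) := by
  intro a b hab
  refine lintegral_mono fun t => ENNReal.ofReal_le_ofReal ?_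
  split_ifs with hb ha
  · exact profile_antitone hρ t hab
  · exact absurd (hab.trans hb) ha
  · exact profile_nonneg hρ t a
  · exact le_rfl

theorem profileWeight_eq_zero {ρ W r : ℝ} (T : ℝ) (hr : ρ * (1 + W) < r) :
    profileWeight ρ W T r = 0 := by
  simp [profileWeight, hr.not_ge]

theorem lintegral_profileWeight_le (m : ℕ) {ρ W T : ℝ} (hρ : 0 < ρ) (hρ1 : ρ ≤ 1) (hW0 : 0 ≤ W)
    (hW : W ≤ 1 / 10) (hT : 0 < T) (hTW : (m + 1) ^ 2 * T / 8 * (6 * W) ≤ 1) :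
    ∫⁻ x : Euc (m + 1), profileWeight ρ W T ‖x‖ ≤
      volume (Metric.ball (0 : Euc (m + 1)) 1) *
        ENNReal.ofReal (240 / (m + 1) ^ 2 * Real.exp ((m + 1) ^ 2 * T / 8)) := by
  have hmeas : Measurable fun p : Euc (m + 1) × ℝ =>
      ENNReal.ofReal (if ‖p.1‖ ≤ ρ * (1 + W) then profile ρ p.2 ‖p.1‖ else 0) :=
    (Measurable.ite (measurableSet_le (by fun_prop) measurable_const)
      ((measurable_profile ρ).comp (by fun_prop : Measurable fun p : Euc (m + 1) × ℝ =>
        (p.2, ‖p.1‖))) measurable_const).ennreal_ofReal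
  unfold profileWeight
  rw [lintegral_lintegral_swap hmeas.aemeasurable]
  calc _ ≤ ∫⁻ t in Set.Ioc 0 T, volume (Metric.ball (0 : Euc (m + 1)) 1) *
          (ENNReal.ofReal 30 * ENNReal.ofReal (Real.exp ((m + 1) ^ 2 / 8 * t))) := by
        refine setLIntegral_mono (by fun_prop) fun t ht => ?_
        rw [← ENNReal.ofReal_mul (by norm_num), div_mul_eq_mul_div]
        refine lintegral_profile_le m hρ hρ1 hW0 hW ht.1 (le_trans ?_ hTW)
        gcongr
        exact ht.2
    _ ≤ volume (Metric.ball (0 : Euc (m + 1)) 1) * (ENNReal.ofReal 30 *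
          ENNReal.ofReal (Real.exp ((m + 1) ^ 2 / 8 * T) / ((m + 1) ^ 2 / 8))) := by
        rw [lintegral_const_mul _ (by fun_prop), lintegral_const_mul _ (by fun_prop)]
        gcongr
        exact setLIntegral_exp_mul_le (by positivity) hT.le
    _ = _ := by
        rw [← ENNReal.ofReal_mul (by norm_num)]
        congr 2
        rw [div_mul_eq_mul_div _ _ T]
        field_simp
        norm_num

theorem exists_lattice_profileWeight_le (m : ℕ) {ρ W T : ℝ} (hρ : 0 < ρ)
    (hρm : ρ ^ (m + 1) ≤ 2 / 5) (hW0 : 0 ≤ W) (hW : W ≤ 1 / 10) (hT : 0 < T)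
    (hTW : (m + 1) ^ 2 * T / 8 * (6 * W) ≤ 1) :
    ∃ A : Euc (m + 1) ≃ₗ[ℝ] Euc (m + 1),
      |LinearMap.det (A : Euc (m + 1) →ₗ[ℝ] Euc (m + 1))| =
        (volume (Metric.ball (0 : Euc (m + 1)) 1)).toReal ∧
      (∀ z : Fin (m + 1) → ℤ, z ≠ 0 → ρ < ‖A (WithLp.toLp 2 fun i => (z i : ℝ))‖) ∧
      ∑' z : Fin (m + 1) → ℤ, (if z = 0 then 0 else
        profileWeight ρ W T ‖A (WithLp.toLp 2 fun i => (z i : ℝ))‖) ≤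
      ENNReal.ofReal (480 / (m + 1) ^ 2 * Real.exp ((m + 1) ^ 2 * T / 8)) := by
  have hρ1 : ρ ≤ 1 := by
    by_contra! h
    have := one_lt_pow₀ h m.succ_ne_zero
    rw [Nat.succ_eq_add_one] at this
    linarith
  set M : ℝ := 480 / (m + 1) ^ 2 * Real.exp ((m + 1) ^ 2 * T / 8) with hM
  have hM0 : 0 < M := by positivity
  have hM0' : ENNReal.ofReal M ≠ 0 := (ENNReal.ofReal_pos.2 hM0).ne'
  set v := volume (Metric.ball (0 : Euc (m + 1)) 1) with hv
  have hv0 : v ≠ 0 := (Metric.measure_ball_pos _ _ one_pos).ne'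
  have hvtop : v ≠ ⊤ := measure_ball_lt_top.ne
  set f : ℝ → ENNReal := fun r =>
    (if r ≤ ρ then 1 else 0) + (ENNReal.ofReal M)⁻¹ * profileWeight ρ W T r with hf
  have hfanti : Antitone f := by
    intro a b hab
    refine add_le_add ?_ (mul_le_mul_right (profileWeight_antitone hρ W T hab) _)
    split_ifs with hb ha
    · exact le_rfl
    · exact absurd (hab.trans hb) ha
    · exact zero_le_one
    · exact le_rfl
  have hfR : ∀ r, ρ * (1 + W) < r → f r = 0 := by
    intro r hr
    have h1 : ρ < r := lt_of_le_of_lt (le_mul_of_one_le_right hρ.le (by linarith)) hr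
    simp [hf, profileWeight_eq_zero T hr, h1.not_ge]
  obtain ⟨A, hdet, hsum⟩ := exists_lattice_tsum_le m (ENNReal.toReal_pos hv0 hvtop) f hfanti hfR
  rw [ENNReal.ofReal_toReal hvtop] at hsum
  have hint : ∫⁻ x : Euc (m + 1), f ‖x‖ ≤ v * ENNReal.ofReal (9 / 10) := by
    have h1 : ∫⁻ x : Euc (m + 1), (if ‖x‖ ≤ ρ then (1 : ENNReal) else 0) =
        v * ENNReal.ofReal (ρ ^ (m + 1)) := by
      have h2 : (fun x : Euc (m + 1) => if ‖x‖ ≤ ρ then (1 : ENNReal) else 0) =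
          (Metric.closedBall (0 : Euc (m + 1)) ρ).indicator 1 := by
        ext x
        classical simp [Set.indicator_apply]
      rw [h2, lintegral_indicator_one Metric.isClosed_closedBall.measurableSet,
        Measure.addHaar_closedBall _ _ hρ.le, finrank_euclideanSpace_fin, mul_comm]
    have hmw : Measurable fun x : Euc (m + 1) => profileWeight ρ W T ‖x‖ :=
      (profileWeight_antitone hρ W T).measurable.comp measurable_norm
    rw [hf, lintegral_add_right _ (hmw.const_mul _), h1, lintegral_const_mul _ hmw]
    calc _ ≤ v * ENNReal.ofReal (2 / 5) + (ENNReal.ofReal M)⁻¹ *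
            (v * ENNReal.ofReal (M * (1 / 2))) := by
          gcongr
          refine (lintegral_profileWeight_le m hρ hρ1 hW0 hW hT hTW).trans_eq ?_
          rw [hM]
          congr 2
          ring
      _ = v * ENNReal.ofReal (2 / 5) +
            (ENNReal.ofReal M)⁻¹ * ENNReal.ofReal M * (v * ENNReal.ofReal (1 / 2)) := by
          rw [ENNReal.ofReal_mul hM0.le]
          ring
      _ = _ := by
          rw [ENNReal.inv_mul_cancel hM0' ENNReal.ofReal_ne_top, one_mul, ← mul_add,
            ← ENNReal.ofReal_add (by norm_num) (by norm_num)]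
          norm_num
  have hlt : ∑' z : Fin (m + 1) → ℤ,
      (if z = 0 then 0 else f ‖A (WithLp.toLp 2 fun i => (z i : ℝ))‖) < 1 := by
    refine (hsum.trans (ENNReal.div_le_of_le_mul' hint)).trans_lt ?_
    rw [← ENNReal.ofReal_one, ENNReal.ofReal_lt_ofReal_iff one_pos]
    norm_num
  refine ⟨A, hdet, fun z hz => ?_, ?_⟩
  · by_contra! hle
    refine hlt.not_ge (le_trans ?_ (ENNReal.le_tsum z))
    simp [hz, hf, hle]
  · have h1 : (ENNReal.ofReal M)⁻¹ * ∑' z : Fin (m + 1) → ℤ, (if z = 0 then 0 else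
        profileWeight ρ W T ‖A (WithLp.toLp 2 fun i => (z i : ℝ))‖) ≤ 1 := by
      rw [← ENNReal.tsum_mul_left]
      refine le_trans (ENNReal.tsum_le_tsum fun z => ?_) hlt.le
      split_ifs
      · simp
      · exact le_add_self
    rwa [ENNReal.inv_mul_le_iff hM0' ENNReal.ofReal_ne_top, mul_one] at h1

theorem norm_le_of_mem_Dset {n : ℕ} {ρ W C₀ t : ℝ} (hρ : 0 < ρ) (hρ1 : ρ ≤ 1) (hW : W ≤ 1 / 10)
    (hC : 0 ≤ C₀) (htW : C₀ * √(t * n) ≤ W) {x : Euc n} (hx : x ∈ Dset (ρ ^ 2)⁻¹ C₀ t) :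
    ‖x‖ ≤ ρ * (1 + W) := by
  have hW0 : 0 ≤ W := le_trans (by positivity) htW
  by_contra! h
  have hx1 : ((ρ ^ 2)⁻¹ - W) * ‖x‖ ^ 2 < 1 := by
    refine lt_of_le_of_lt ?_ hx
    gcongr
  have hρ2 : ρ ^ 2 ≤ 1 := pow_le_one₀ hρ.le hρ1
  have hpos : 0 < (ρ ^ 2)⁻¹ - W := by
    linarith [(one_le_inv₀ (by positivity)).2 hρ2]
  have h2 : ((ρ ^ 2)⁻¹ - W) * (ρ * (1 + W)) ^ 2 ≤ ((ρ ^ 2)⁻¹ - W) * ‖x‖ ^ 2 := by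
    gcongr
  have h3 : ((ρ ^ 2)⁻¹ - W) * (ρ * (1 + W)) ^ 2 = (1 - W * ρ ^ 2) * (1 + W) ^ 2 := by
    field_simp
  have h4 : (1 - W) * (1 + W) ^ 2 ≤ (1 - W * ρ ^ 2) * (1 + W) ^ 2 := by
    gcongr
    nlinarith
  nlinarith [mul_nonneg hW0 hW0]

theorem exists_int_of_mem_image {n : ℕ} (A : Euc n ≃ₗ[ℝ] Euc n) {x : Euc n}
    (hx : x ∈ A '' intPoints n) (hx0 : x ≠ 0) :
    ∃ z : Fin n → ℤ, z ≠ 0 ∧ A (WithLp.toLp 2 fun i => (z i : ℝ)) = x := by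
  obtain ⟨y, hy, rfl⟩ := hx
  choose z hz using hy
  have hyz : y = WithLp.toLp 2 fun i => (z i : ℝ) := by
    ext i
    exact hz i
  refine ⟨z, ?_, by rw [hyz]⟩
  rintro rfl
  refine hx0 ?_
  have hy0 : y = 0 := by
    ext i
    simp [hyz]
  rw [hy0, map_zero]

theorem ofReal_Kt_le {n : ℕ} {ρ W C₀ t : ℝ} (hρ : 0 < ρ) (hρ1 : ρ ≤ 1) (hW : W ≤ 1 / 10)
    (hC : 0 ≤ C₀) (htW : C₀ * √(t * n) ≤ W) (A : Euc n ≃ₗ[ℝ] Euc n)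
    (hA : ∀ z : Fin n → ℤ, z ≠ 0 → ρ < ‖A (WithLp.toLp 2 fun i => (z i : ℝ))‖) :
    ENNReal.ofReal (Kt C₀ (ρ ^ 2)⁻¹ (A '' intPoints n) t) ≤
      ∑' z : Fin n → ℤ, (if z = 0 then 0 else
        ENNReal.ofReal (if ‖A (WithLp.toLp 2 fun i => (z i : ℝ))‖ ≤ ρ * (1 + W) then
          profile ρ t ‖A (WithLp.toLp 2 fun i => (z i : ℝ))‖ else 0)) := by
  have hex : ∀ x : ↥((A '' intPoints n ∩ Dset (ρ ^ 2)⁻¹ C₀ t) \ {0}),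
      ∃ z : Fin n → ℤ, z ≠ 0 ∧ A (WithLp.toLp 2 fun i => (z i : ℝ)) = x :=
    fun x => exists_int_of_mem_image A x.2.1.1 x.2.2
  choose z hz0 hz using hex
  have hz_inj : Function.Injective z := fun x y hxy =>
    Subtype.ext (by rw [← hz x, ← hz y, hxy])
  have hnorm : ∀ x : ↥((A '' intPoints n ∩ Dset (ρ ^ 2)⁻¹ C₀ t) \ {0}), ρ < ‖(x : Euc n)‖ :=
    fun x => hz x ▸ hA (z x) (hz0 x)
  refine le_trans ?_ (ENNReal.tsum_comp_le_tsum_of_injective hz_inj _)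
  unfold Kt
  by_cases hs : Summable fun x : ↥((A '' intPoints n ∩ Dset (ρ ^ 2)⁻¹ C₀ t) \ {0}) =>
      Phi (((ρ ^ 2)⁻¹ - 1 / ‖(x : Euc n)‖ ^ 2) / √t)
  · rw [ENNReal.ofReal_tsum_of_nonneg
      (fun x => Phi_nonneg (profile_arg_nonneg hρ t (hnorm x))) hs]
    refine ENNReal.tsum_le_tsum fun x => ?_
    rw [if_neg (hz0 x), hz x, if_pos (norm_le_of_mem_Dset hρ hρ1 hW hC htW x.2.1.2), profile,
      if_neg (hnorm x).not_ge]
  · rw [tsum_eq_zero_of_not_summable hs]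
    simp

theorem integral_Kt_le {n : ℕ} {ρ W C₀ T M : ℝ} (hρ : 0 < ρ) (hρ1 : ρ ≤ 1) (hW : W ≤ 1 / 10)
    (hC : 0 ≤ C₀) (hT : 0 ≤ T) (hTW : C₀ * √(T * n) ≤ W) (hM : 0 ≤ M) (A : Euc n ≃ₗ[ℝ] Euc n)
    (hA : ∀ z : Fin n → ℤ, z ≠ 0 → ρ < ‖A (WithLp.toLp 2 fun i => (z i : ℝ))‖)
    (hsum : ∑' z : Fin n → ℤ, (if z = 0 then 0 else
      profileWeight ρ W T ‖A (WithLp.toLp 2 fun i => (z i : ℝ))‖) ≤ ENNReal.ofReal M) :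
    ∫ t in (0 : ℝ)..T, Kt C₀ (ρ ^ 2)⁻¹ (A '' intPoints n) t ≤ M := by
  rw [intervalIntegral.integral_of_le hT]
  by_cases hi : IntegrableOn (Kt C₀ (ρ ^ 2)⁻¹ (A '' intPoints n)) (Set.Ioc 0 T)
  swap
  · rwa [integral_undef hi]
  rw [integral_eq_lintegral_pos_part_sub_lintegral_neg_part hi]
  refine (sub_le_self _ ENNReal.toReal_nonneg).trans (ENNReal.toReal_le_of_le_ofReal hM ?_)
  refine le_trans ?_ hsum
  have hprof : ∀ r : ℝ, Measurable fun t => profile ρ t r := fun r =>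
    (measurable_profile ρ).comp (by fun_prop : Measurable fun t : ℝ => (t, r))
  calc _ ≤ ∫⁻ t in Set.Ioc 0 T, ∑' z : Fin n → ℤ, (if z = 0 then 0 else
        ENNReal.ofReal (if ‖A (WithLp.toLp 2 fun i => (z i : ℝ))‖ ≤ ρ * (1 + W) then
          profile ρ t ‖A (WithLp.toLp 2 fun i => (z i : ℝ))‖ else 0)) := by
        refine setLIntegral_mono' measurableSet_Ioc fun t ht =>
          ofReal_Kt_le hρ hρ1 hW hC (le_trans ?_ hTW) A hA
        gcongr
        exact ht.2
    _ = _ := by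
        rw [lintegral_tsum fun z => ?_]
        · congr 1
          ext1 z
          by_cases hz : z = 0
          · simp [hz]
          · simp only [if_neg hz]
            rfl
        · refine Measurable.aemeasurable ?_
          split_ifs
          · exact measurable_const
          · exact (hprof _).ennreal_ofReal
          · simp

theorem eventually_log_bounds (C₀ : ℝ) : ∀ᶠ n : ℕ in Filter.atTop,
    C₀ * √(20 * Real.log n / n) ≤ 1 / 10 ∧
      15 * (C₀ * √(20 * Real.log n / n)) * Real.log n ≤ 1 := by
  have h3 : Filter.Tendsto (fun n : ℕ => Real.log n ^ 3 / n) Filter.atTop (nhds 0) :=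
    (by simpa using Real.tendsto_pow_log_div_mul_add_atTop 1 0 3 one_ne_zero :
      Filter.Tendsto (fun x : ℝ => Real.log x ^ 3 / x) Filter.atTop (nhds 0)).comp
      tendsto_natCast_atTop_atTop
  have h4 : Filter.Tendsto (fun n : ℕ => 15 * C₀ * √(20 * (Real.log n ^ 3 / n)))
      Filter.atTop (nhds 0) := by
    simpa using ((h3.const_mul 20).sqrt).const_mul (15 * C₀)
  have hlog : Filter.Tendsto (fun n : ℕ => Real.log n) Filter.atTop Filter.atTop :=
    Real.tendsto_log_atTop.comp tendsto_natCast_atTop_atTop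
  filter_upwards [h4.eventually (ge_mem_nhds one_pos), hlog.eventually_ge_atTop 1]
    with n hn hn1
  have hkey : 15 * (C₀ * √(20 * Real.log n / n)) * Real.log n =
      15 * C₀ * √(20 * (Real.log n ^ 3 / n)) := by
    rw [show 20 * (Real.log n ^ 3 / (n : ℝ)) = 20 * Real.log n / n * Real.log n ^ 2 by ring,
      Real.sqrt_mul' _ (sq_nonneg _), Real.sqrt_sq (by linarith)]
    ring
  rw [← hkey] at hn
  refine ⟨?_, hn⟩
  by_contra! h
  nlinarith

theorem exists_good_lattice :
    ∀ C₀ : ℝ, 0 < C₀ → ∃ C : ℝ, 0 < C ∧ ∃ N : ℕ, ∀ n : ℕ, N ≤ n →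
      ∀ T : ℝ, 0 < T → T ≤ 20 * Real.log n / (n : ℝ) ^ 2 →
        ∃ Tlin : Euc n ≃ₗ[ℝ] Euc n,
          -- the lattice L = Tlin(ℤ^n) has covolume Vol_n(B^n):
          |LinearMap.det (Tlin : Euc n →ₗ[ℝ] Euc n)| =
            (volume (Metric.ball (0 : Euc n) 1)).toReal ∧
          -- a_0|x|² > 1 for every nonzero x ∈ L, with a_0 = (1 − 1/n)^{−2}:
          (∀ x ∈ Tlin '' intPoints n, x ≠ 0 →
            1 < ((1 - 1 / (n : ℝ)) ^ 2)⁻¹ * ‖x‖ ^ 2) ∧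
          -- ∫_0^T K_t(L) dt ≤ (C/n²)·e^{n²T/8}:
          (∫ t in (0 : ℝ)..T,
              Kt C₀ (((1 - 1 / (n : ℝ)) ^ 2)⁻¹) (Tlin '' intPoints n) t) ≤
            C / (n : ℝ) ^ 2 * Real.exp ((n : ℝ) ^ 2 * T / 8) := by
  intro C₀ hC₀
  obtain ⟨N, hN⟩ := Filter.eventually_atTop.1 (eventually_log_bounds C₀)
  refine ⟨480, by norm_num, max N 2, fun n hn T hT0 hT => ?_⟩
  obtain ⟨hW, hWlog⟩ := hN n (le_of_max_le_left hn)
  have hn2 : 2 ≤ n := le_of_max_le_right hn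
  obtain ⟨m, rfl⟩ : ∃ m, n = m + 1 := ⟨n - 1, by omega⟩
  set L : ℝ := Real.log ((m + 1 : ℕ) : ℝ) with hL
  set W : ℝ := C₀ * √(20 * L / ((m + 1 : ℕ) : ℝ)) with hWdef
  have hn0 : (0 : ℝ) < ((m + 1 : ℕ) : ℝ) := by positivity
  have hW0 : 0 ≤ W := by positivity
  have hTn : ((m + 1 : ℕ) : ℝ) ^ 2 * T ≤ 20 * L := by
    rwa [le_div_iff₀ (by positivity), mul_comm] at hT
  have hTW : C₀ * √(T * ((m + 1 : ℕ) : ℝ)) ≤ W := by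
    rw [hWdef]
    gcongr
    rw [le_div_iff₀ hn0]
    linarith
  have hTW' : ((m : ℝ) + 1) ^ 2 * T / 8 * (6 * W) ≤ 1 := by
    push_cast at hTn
    nlinarith
  set ρ : ℝ := 1 - 1 / ((m + 1 : ℕ) : ℝ) with hρdef
  have hinv : 1 / ((m + 1 : ℕ) : ℝ) ≤ 1 / 2 :=
    one_div_le_one_div_of_le two_pos (by exact_mod_cast hn2)
  have hρ : 0 < ρ := by linarith
  have hρ1 : ρ ≤ 1 := by linarith [one_div_pos.2 hn0]
  have hρm : ρ ^ (m + 1) ≤ 2 / 5 := by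
    calc ρ ^ (m + 1) ≤ Real.exp (-1) := Real.one_sub_div_pow_le_exp_neg (by exact_mod_cast hn0)
      _ ≤ 2 / 5 := by
        rw [Real.exp_neg, inv_le_comm₀ (Real.exp_pos 1) (by norm_num)]
        linarith [Real.exp_one_gt_d9]
  obtain ⟨A, hdet, hA, hsum⟩ := exists_lattice_profileWeight_le m hρ hρm hW0 hW hT0 hTW'
  refine ⟨A, hdet, ?_, ?_⟩
  · intro x hx hx0
    obtain ⟨z, hz0, rfl⟩ := exists_int_of_mem_image A hx hx0
    rw [inv_mul_eq_div, one_lt_div (by positivity)]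
    have := hA z hz0
    gcongr
  · refine integral_Kt_le hρ hρ1 hW hC₀.le hT0.le hTW (by positivity) A hA (hsum.trans_eq ?_)
    push_cast
    rfl
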